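/- Let f : ℝⁿ → ℝ be continuously differentiable with inf_{x ∈ ℝⁿ} f(x) > −∞, and let (x_k) be a bounded sequence in ℝⁿ such that for some α, β > 0 and all k: (H1) f(x_k) − f(x_{k+1}) ≥ α‖x_{k+1} − x_k‖², and (H2) ‖∇f(x_{k+1})‖ ≤ β‖x_{k+1} − x_k‖. If the set of stationary points S := {x ∈ ℝⁿ | ∇f(x) = 0} is nonempty, then dist(x_k, S) → 0 as k → ∞. -/

import Mathlib

open Filter Set

/-- Along a bounded sequence in a proper space, if the values of a continuous map tend to `c`,
then the sequence approaches the fibre over `c`. -/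
theorem tendsto_infDist_fiber_of_isBounded {X Y : Type*} [PseudoMetricSpace X] [ProperSpace X]
    [TopologicalSpace Y] [T2Space Y] {g : X → Y} (hg : Continuous g) {x : ℕ → X}
    (hx : Bornology.IsBounded (Set.range x)) {c : Y}
    (hc : Tendsto (fun k => g (x k)) atTop (nhds c)) :
    Tendsto (fun k => Metric.infDist (x k) {z | g z = c}) atTop (nhds 0) := by
  refine tendsto_of_subseq_tendsto fun ns hns => ?_
  obtain ⟨a, -, φ, hφ, ha⟩ :=
    tendsto_subseq_of_bounded hx (x := x ∘ ns) fun k => Set.mem_range_self (ns k)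
  refine ⟨φ, ?_⟩
  have hga : g a = c :=
    tendsto_nhds_unique ((hg.tendsto a).comp ha) (hc.comp (hns.comp hφ.tendsto_atTop))
  have h := ((Metric.continuous_infDist_pt {z | g z = c}).tendsto a).comp ha
  rwa [Metric.infDist_zero_of_mem (show a ∈ {z | g z = c} from hga)] at h

theorem continuous_gradient_of_contDiff {E : Type*} [NormedAddCommGroup E]
    [InnerProductSpace ℝ E] [CompleteSpace E] {f : E → ℝ} (hf : ContDiff ℝ 1 f) :
    Continuous (gradient f) :=
  (InnerProductSpace.toDual ℝ E).symm.continuous.comp (hf.continuous_fderiv one_ne_zero)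

/-- Under sufficient decrease of a function bounded below, the step lengths tend to zero. -/
theorem tendsto_norm_step_of_sufficient_decrease {E : Type*} [SeminormedAddCommGroup E]
    {f : E → ℝ} (hbdd : BddBelow (Set.range f)) {x : ℕ → E} {α : ℝ} (hα : 0 < α)
    (h : ∀ k : ℕ, f (x k) - f (x (k + 1)) ≥ α * ‖x (k + 1) - x k‖ ^ 2) :
    Tendsto (fun k => ‖x (k + 1) - x k‖) atTop (nhds 0) := by
  have hanti : Antitone fun k => f (x k) := antitone_nat_of_succ_le fun k => by
    have : 0 ≤ α * ‖x (k + 1) - x k‖ ^ 2 := by positivity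
    linarith [h k]
  have hlim := tendsto_atTop_ciInf hanti (hbdd.mono (Set.range_comp_subset_range x f))
  have hdiff : Tendsto (fun k => (f (x k) - f (x (k + 1))) / α) atTop (nhds 0) := by
    simpa using (hlim.sub (hlim.comp (tendsto_add_atTop_nat 1))).div_const α
  have hsq : Tendsto (fun k => ‖x (k + 1) - x k‖ ^ 2) atTop (nhds 0) :=
    squeeze_zero (fun k => by positivity)
      (fun k => by rw [le_div_iff₀ hα, mul_comm]; exact h k) hdiff
  simpa using hsq.sqrt

/-- Descent method under (H1)–(H2) with bounded iterates: if
`f : ℝⁿ → ℝ` is `C¹` and bounded below, `(x_k)` is bounded and satisfies the sufficient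
decrease and relative error conditions, and the stationary set `S = (∇f)⁻¹(0)` is
nonempty, then `dist(x_k, S) → 0`. -/
theorem descent_convergence_of_bounded
    {n : ℕ} (f : EuclideanSpace ℝ (Fin n) → ℝ)
    (hf : ContDiff ℝ 1 f)
    (hbdd : BddBelow (Set.range f))
    (x : ℕ → EuclideanSpace ℝ (Fin n))
    (hxb : Bornology.IsBounded (Set.range x))
    (α β : ℝ) (hα : 0 < α) (hβ : 0 < β)
    (hH1 : ∀ k : ℕ, f (x k) - f (x (k + 1)) ≥ α * ‖x (k + 1) - x k‖ ^ 2)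
    (hH2 : ∀ k : ℕ, ‖gradient f (x (k + 1))‖ ≤ β * ‖x (k + 1) - x k‖)
    (S : Set (EuclideanSpace ℝ (Fin n)))
    (hSdef : S = {z | gradient f z = 0}) (hSne : S.Nonempty) :
    Tendsto (fun k => Metric.infDist (x k) S) atTop (nhds 0) := by
  subst hSdef
  refine tendsto_infDist_fiber_of_isBounded (continuous_gradient_of_contDiff hf) hxb ?_
  rw [← tendsto_add_atTop_iff_nat 1]
  refine squeeze_zero_norm hH2 ?_
  simpa using (tendsto_norm_step_of_sufficient_decrease hbdd hα hH1).const_mul β
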